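/- arXiv:1711.11215 — 2 statements merged into one kernel-verified Lean document; each statement's English description precedes it below -/
import Mathlib

section
/- Let M ≥ 2 be an even integer (M = 2^b for a positive integer b), fix σ > 0 and δ ∈ (1 − 1/M, ∞), and define F_M : (0, ∞) → ℝ by F_M(τ) = (τ/2)(δ − (M−1)/M) + σ²/(2τ) + (1/M)·Σ_{k ∈ {2, 4, …, 2(M−1)}} S(τ; k), where S(τ; k) = (τ + k²/τ)·Q(k/τ) − (k/√(2π))·e^{−k²/(2τ²)}. Then F_M is strictly convex on (0, ∞) and has a unique positive minimizer. -/
open Real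

/-- The standard normal tail function `Q(x) = ∫_x^∞ (2π)^{-1/2} e^{-t²/2} dt`. -/
noncomputable def Qfun (x : ℝ) : ℝ :=
  ∫ t in Set.Ioi x, (Real.sqrt (2 * Real.pi))⁻¹ * Real.exp (-t ^ 2 / 2)

/-- `S(τ; k)` from the M-PAM theorem. -/
noncomputable def SPAM (k τ : ℝ) : ℝ :=
  (τ + k ^ 2 / τ) * Qfun (k / τ) - (k / Real.sqrt (2 * Real.pi)) * Real.exp (-k ^ 2 / (2 * τ ^ 2))

/-- The function `F_M` from the M-PAM theorem, with parameters `M`, `σ` and `δ`.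
The sum ranges over `k ∈ {2, 4, …, 2(M-1)}`. -/
noncomputable def FM (M : ℕ) (σ δ τ : ℝ) : ℝ :=
  (τ / 2) * (δ - ((M : ℝ) - 1) / M) + σ ^ 2 / (2 * τ)
    + (1 / (M : ℝ)) * ∑ j ∈ Finset.range (M - 1), SPAM (2 * ((j : ℝ) + 1)) τ

theorem integrable_gaussian_density :
    MeasureTheory.Integrable fun t : ℝ => (√(2 * π))⁻¹ * exp (-t ^ 2 / 2) := by
  have h := (integrable_exp_neg_mul_sq (b := 1 / 2) (by norm_num)).const_mul (√(2 * π))⁻¹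
  refine h.congr (Filter.Eventually.of_forall fun t => ?_)
  simp only
  congr 2
  ring

theorem hasDerivAt_Qfun (x : ℝ) :
    HasDerivAt Qfun (-((√(2 * π))⁻¹ * exp (-x ^ 2 / 2))) x := by
  have hQ : Qfun = fun x => Qfun 0 - ∫ t in (0 : ℝ)..x, (√(2 * π))⁻¹ * exp (-t ^ 2 / 2) := by
    funext y
    have h := intervalIntegral.integral_interval_add_Ioi
      (integrable_gaussian_density.integrableOn (s := Set.Ioi 0))
      (integrable_gaussian_density.integrableOn (s := Set.Ioi y))
    exact eq_sub_of_add_eq' h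
  rw [hQ]
  have hc : Continuous fun t : ℝ => (√(2 * π))⁻¹ * exp (-t ^ 2 / 2) := by fun_prop
  exact (hc.integral_hasStrictDerivAt 0 x).hasDerivAt.const_sub _

theorem Qfun_nonneg (x : ℝ) : 0 ≤ Qfun x :=
  MeasureTheory.integral_nonneg fun t => by positivity

theorem hasDerivAt_SPAM (k : ℝ) {τ : ℝ} (hτ : 0 < τ) :
    HasDerivAt (SPAM k) ((1 - k ^ 2 / τ ^ 2) * Qfun (k / τ)
      + k / τ * ((√(2 * π))⁻¹ * exp (-(k / τ) ^ 2 / 2))) τ := by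
  have hτ0 := hτ.ne'
  have hdiv (c : ℝ) : HasDerivAt (fun t : ℝ => c / t) (-c / τ ^ 2) τ := by
    simpa using (hasDerivAt_const τ c).fun_div (hasDerivAt_id τ) hτ0
  have hQ := (hasDerivAt_Qfun (k / τ)).comp τ (hdiv k)
  have hE := ((((hdiv k).pow 2).neg.div_const 2).exp).const_mul (k / √(2 * π))
  have h := (((hasDerivAt_id τ).add (hdiv (k ^ 2))).mul hQ).sub hE
  have hpi : √(2 * π) ≠ 0 := by positivity
  refine (h.congr_of_eventuallyEq ?_).congr_deriv ?_
  · refine Filter.Eventually.of_forall fun t => ?_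
    simp only [SPAM, Pi.sub_apply, Pi.mul_apply, Pi.add_apply, Pi.neg_apply, Pi.pow_apply,
      Function.comp_apply, id]
    congr 3
    rw [div_pow, neg_div, neg_div, div_div, mul_comm]
  · simp only [Pi.add_apply, Pi.neg_apply, Pi.pow_apply, Function.comp_apply, id,
      Nat.add_one_sub_one, pow_one]
    field_simp
    ring

theorem hasDerivAt_deriv_SPAM (k : ℝ) {τ : ℝ} (hτ : 0 < τ) :
    HasDerivAt (fun τ => (1 - k ^ 2 / τ ^ 2) * Qfun (k / τ)
      + k / τ * ((√(2 * π))⁻¹ * exp (-(k / τ) ^ 2 / 2))) (2 * k ^ 2 / τ ^ 3 * Qfun (k / τ)) τ := by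
  have hτ0 := hτ.ne'
  have hdiv : HasDerivAt (fun t : ℝ => k / t) (-k / τ ^ 2) τ := by
    simpa using (hasDerivAt_const τ k).fun_div (hasDerivAt_id τ) hτ0
  have hQ := (hasDerivAt_Qfun (k / τ)).comp τ hdiv
  have hE := (((hdiv.pow 2).neg.div_const 2).exp).const_mul (√(2 * π))⁻¹
  have h := (((hdiv.pow 2).const_sub 1).mul hQ).add (hdiv.mul hE)
  have hpi : √(2 * π) ≠ 0 := by positivity
  refine (h.congr_of_eventuallyEq ?_).congr_deriv ?_
  · refine Filter.Eventually.of_forall fun t => ?_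
    simp [div_pow]
  · simp only [Pi.neg_apply, Pi.pow_apply, Function.comp_apply, Nat.add_one_sub_one, pow_one]
    field_simp
    ring

theorem convexOn_SPAM (k : ℝ) : ConvexOn ℝ (Set.Ioi 0) (SPAM k) := by
  refine convexOn_of_hasDerivWithinAt2_nonneg (convex_Ioi 0)
    (fun τ hτ => (hasDerivAt_SPAM k hτ).continuousAt.continuousWithinAt)
    (fun τ hτ => (hasDerivAt_SPAM k (interior_subset hτ)).hasDerivWithinAt)
    (fun τ hτ => (hasDerivAt_deriv_SPAM k (interior_subset hτ)).hasDerivWithinAt)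
    fun τ hτ => ?_
  have hτ' : 0 < τ := interior_subset hτ
  have := Qfun_nonneg (k / τ)
  positivity

theorem neg_le_SPAM {k τ : ℝ} (hk : 0 ≤ k) (hτ : 0 < τ) : -(k / √(2 * π)) ≤ SPAM k τ := by
  have hQ := Qfun_nonneg (k / τ)
  have h1 : 0 ≤ (τ + k ^ 2 / τ) * Qfun (k / τ) := by positivity
  have h2 : exp (-k ^ 2 / (2 * τ ^ 2)) ≤ 1 :=
    exp_le_one_iff.2 (by rw [neg_div]; exact neg_nonpos.2 (by positivity))
  have h3 := mul_le_of_le_one_right (show 0 ≤ k / √(2 * π) by positivity) h2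
  unfold SPAM
  linarith

theorem strictConvexOn_FM (M : ℕ) {σ : ℝ} (δ : ℝ) (hσ : 0 < σ) :
    StrictConvexOn ℝ (Set.Ioi 0) (FM M σ δ) := by
  have hlin : ConvexOn ℝ (Set.Ioi (0 : ℝ)) fun τ => τ / 2 * (δ - ((M : ℝ) - 1) / M) := by
    refine ⟨convex_Ioi 0, fun x _ y _ a b _ _ _ => le_of_eq ?_⟩
    simp only [smul_eq_mul]
    ring
  have hinv : StrictConvexOn ℝ (Set.Ioi (0 : ℝ)) fun τ => σ ^ 2 / (2 * τ) := by
    refine ⟨convex_Ioi 0, fun x hx y hy hxy a b ha hb hab => ?_⟩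
    have h := (strictConvexOn_zpow (m := -1) (by norm_num) (by norm_num)).2 hx hy hxy ha hb hab
    simp only [smul_eq_mul, zpow_neg_one] at h ⊢
    have := mul_lt_mul_of_pos_left h (show 0 < σ ^ 2 / 2 by positivity)
    simp only [div_eq_mul_inv, mul_inv] at this ⊢
    linarith
  have hsum : ConvexOn ℝ (Set.Ioi (0 : ℝ)) fun τ =>
      ∑ j ∈ Finset.range (M - 1), SPAM (2 * ((j : ℝ) + 1)) τ := by
    refine ⟨convex_Ioi 0, fun x hx y hy a b ha hb hab => ?_⟩
    simp only [Finset.smul_sum, ← Finset.sum_add_distrib]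
    exact Finset.sum_le_sum fun j _ => (convexOn_SPAM _).2 hx hy ha hb hab
  exact (hlin.add_strictConvexOn hinv).add_convexOn
    (hsum.smul (show (0 : ℝ) ≤ 1 / (M : ℝ) by positivity))

theorem continuousOn_FM (M : ℕ) (σ δ : ℝ) : ContinuousOn (FM M σ δ) (Set.Ioi 0) := by
  unfold FM
  refine ContinuousOn.add (ContinuousOn.add (by fun_prop) ?_) (ContinuousOn.mul (by fun_prop) ?_)
  · exact continuousOn_const.div (by fun_prop) fun τ hτ => mul_ne_zero two_ne_zero (ne_of_gt hτ)
  · exact continuousOn_finsetSum _ fun j _ τ hτ =>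
      (hasDerivAt_SPAM _ hτ).continuousAt.continuousWithinAt

theorem exists_le_FM (M : ℕ) (σ δ : ℝ) : ∃ C : ℝ, ∀ τ, 0 < τ →
    (δ - ((M : ℝ) - 1) / M) / 2 * τ + σ ^ 2 / 2 / τ + C ≤ FM M σ δ τ := by
  refine ⟨1 / (M : ℝ) * ∑ j ∈ Finset.range (M - 1), -(2 * ((j : ℝ) + 1) / √(2 * π)),
    fun τ hτ => ?_⟩
  have h := mul_le_mul_of_nonneg_left
    (Finset.sum_le_sum fun j (_ : j ∈ Finset.range (M - 1)) =>
      neg_le_SPAM (show 0 ≤ 2 * ((j : ℝ) + 1) by positivity) hτ)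
    (show (0 : ℝ) ≤ 1 / (M : ℝ) by positivity)
  have e : σ ^ 2 / 2 / τ = σ ^ 2 / (2 * τ) := div_div _ _ _
  unfold FM
  linarith

/-- A continuous function on `(0, ∞)` bounded below by `a τ + s / τ + C` with `a, s > 0` attains
its minimum. -/
theorem exists_isMinOn_Ioi_of_le {f : ℝ → ℝ} {a s C : ℝ} (ha : 0 < a) (hs : 0 < s)
    (hf : ContinuousOn f (Set.Ioi 0)) (hle : ∀ τ, 0 < τ → a * τ + s / τ + C ≤ f τ) :
    ∃ x, 0 < x ∧ ∀ τ, 0 < τ → f x ≤ f τ := by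
  have hD : 0 < |f 1 - C| + 1 := by positivity
  have hDC := le_abs_self (f 1 - C)
  set D := |f 1 - C| + 1
  have hε : 0 < min 1 (s / D) := lt_min one_pos (div_pos hs hD)
  have h1 : (1 : ℝ) ∈ Set.Icc (min 1 (s / D)) (max 1 (D / a)) :=
    ⟨min_le_left _ _, le_max_left _ _⟩
  obtain ⟨x, hx, hmin⟩ := isCompact_Icc.exists_isMinOn ⟨1, h1⟩
    (hf.mono fun τ hτ => hε.trans_le hτ.1)
  refine ⟨x, hε.trans_le hx.1, fun τ hτ => ?_⟩
  by_cases hmem : τ ∈ Set.Icc (min 1 (s / D)) (max 1 (D / a))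
  · exact hmin hmem
  refine (hmin h1 : f x ≤ f 1).trans (le_trans ?_ (hle τ hτ))
  have hpos1 : 0 < a * τ := mul_pos ha hτ
  have hpos2 : 0 < s / τ := div_pos hs hτ
  rcases not_and_or.1 hmem with h | h
  · have h2 : τ < s / D := (not_le.1 h).trans_le (min_le_right _ _)
    have h3 : D < s / τ := by
      rw [lt_div_iff₀ hD] at h2
      rw [lt_div_iff₀ hτ]
      linarith
    linarith
  · have h2 : D / a < τ := (le_max_right _ _).trans_lt (not_le.1 h)
    rw [div_lt_iff₀ ha] at h2
    linarith

theorem stmt7 (b : ℕ) (hb : 0 < b) (M : ℕ) (hM : M = 2 ^ b)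
    (σ δ : ℝ) (hσ : 0 < σ) (hδ : 1 - 1 / (M : ℝ) < δ) :
    StrictConvexOn ℝ (Set.Ioi (0 : ℝ)) (FM M σ δ) ∧
      ∃! τs : ℝ, 0 < τs ∧ ∀ τ : ℝ, 0 < τ → FM M σ δ τs ≤ FM M σ δ τ := by
  have hconv := strictConvexOn_FM M δ hσ
  have hM0 : (M : ℝ) ≠ 0 := by simp [hM]
  have ha : 0 < (δ - ((M : ℝ) - 1) / M) / 2 := by
    rw [sub_div (M : ℝ), div_self hM0]
    linarith
  obtain ⟨C, hC⟩ := exists_le_FM M σ δ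
  obtain ⟨x, hx, hmin⟩ := exists_isMinOn_Ioi_of_le ha (show 0 < σ ^ 2 / 2 by positivity)
    (continuousOn_FM M σ δ) hC
  exact ⟨hconv, x, ⟨hx, hmin⟩, fun y hy =>
    hconv.eq_of_isMinOn (fun τ hτ => hy.2 τ hτ) (fun τ hτ => hmin τ hτ) hy.1 hx⟩
end

section
/- Fix a positive integer ℓ and define S_ℓ : (0, ∞) → ℝ by S_ℓ(α) = (α + ℓ²/α)·Q(ℓ/α) − (ℓ/√(2π))·e^{−ℓ²/(2α²)}, with derivative S_ℓ′(α) = (ℓ/(α√(2π)))·e^{−ℓ²/(2α²)} + (1 − ℓ²/α²)·Q(ℓ/α). Then S_ℓ′ is strictly increasing on (0, ∞), satisfies 0 < S_ℓ′(α) < 1/2 for every α > 0, and has limits lim_{α → 0⁺} S_ℓ′(α) = 0 and lim_{α → +∞} S_ℓ′(α) = 1/2. -/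
open Real

/-- The function `S_ℓ` from Lemma 3 of the paper. -/
noncomputable def Sfun (ℓ : ℕ) (α : ℝ) : ℝ :=
  (α + (ℓ : ℝ) ^ 2 / α) * Qfun ((ℓ : ℝ) / α)
    - ((ℓ : ℝ) / Real.sqrt (2 * Real.pi)) * Real.exp (-(ℓ : ℝ) ^ 2 / (2 * α ^ 2))

/-- The first derivative of `S_ℓ`. -/
noncomputable def Sd (ℓ : ℕ) (α : ℝ) : ℝ :=
  ((ℓ : ℝ) / (α * Real.sqrt (2 * Real.pi))) * Real.exp (-(ℓ : ℝ) ^ 2 / (2 * α ^ 2))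
    + (1 - (ℓ : ℝ) ^ 2 / α ^ 2) * Qfun ((ℓ : ℝ) / α)

open MeasureTheory Filter Topology

/-- The standard normal density. -/
noncomputable def stdNormalDensity (x : ℝ) : ℝ :=
  (√(2 * π))⁻¹ * exp (-x ^ 2 / 2)

theorem stdNormalDensity_pos (x : ℝ) : 0 < stdNormalDensity x := by
  unfold stdNormalDensity
  positivity

theorem continuous_stdNormalDensity : Continuous stdNormalDensity := by
  unfold stdNormalDensity
  fun_prop

theorem hasDerivAt_stdNormalDensity (x : ℝ) :
    HasDerivAt stdNormalDensity (-x * stdNormalDensity x) x := by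
  unfold stdNormalDensity
  have h : HasDerivAt (fun y : ℝ => -y ^ 2 / 2) (-x) x := by
    refine ((hasDerivAt_pow 2 x).neg.div_const 2).congr_deriv ?_
    push_cast
    ring
  refine (h.exp.const_mul (√(2 * π))⁻¹).congr_deriv ?_
  ring

theorem integrable_stdNormalDensity : Integrable stdNormalDensity := by
  have h := (integrable_exp_neg_mul_sq (b := 1 / 2) (by norm_num)).const_mul (√(2 * π))⁻¹
  refine h.congr (ae_of_all _ fun x => ?_)
  simp only [stdNormalDensity]
  ring_nf

theorem integrable_sq_mul_stdNormalDensity :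
    Integrable fun x => x ^ 2 * stdNormalDensity x := by
  have h := (integrable_rpow_mul_exp_neg_mul_sq (b := 1 / 2) (by norm_num) (s := 2)
    (by norm_num)).const_mul (√(2 * π))⁻¹
  refine h.congr (ae_of_all _ fun x => ?_)
  simp only [stdNormalDensity, rpow_two]
  ring_nf

theorem tendsto_mul_stdNormalDensity_atTop :
    Tendsto (fun x => x * stdNormalDensity x) atTop (𝓝 0) := by
  have h := (rpow_mul_exp_neg_mul_sq_isLittleO_exp_neg (b := 1 / 2) (by norm_num) 1).isBigO
  have hexp : Tendsto (fun x : ℝ => exp (-(1 / 2) * x)) atTop (𝓝 0) :=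
    tendsto_exp_atBot.comp (tendsto_id.const_mul_atTop_of_neg (by norm_num))
  have h' := (h.trans_tendsto hexp).const_mul (√(2 * π))⁻¹
  rw [mul_zero] at h'
  refine h'.congr fun x => ?_
  simp only [stdNormalDensity, rpow_one]
  ring_nf

theorem Qfun_eq_integral_stdNormalDensity (x : ℝ) :
    Qfun x = ∫ t in Set.Ioi x, stdNormalDensity t := rfl

theorem Qfun_zero : Qfun 0 = 1 / 2 := by
  have h := integral_gaussian_Ioi (1 / 2)
  have h' : (fun t : ℝ => exp (-t ^ 2 / 2)) = fun t => exp (-(1 / 2) * t ^ 2) := by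
    funext t
    ring_nf
  rw [Qfun, integral_const_mul, h', h, show π / (1 / 2) = 2 * π by ring]
  have : 0 < √(2 * π) := by positivity
  field_simp

theorem Qfun_pos (x : ℝ) : 0 < Qfun x := by
  rw [Qfun_eq_integral_stdNormalDensity, setIntegral_pos_iff_support_of_nonneg_ae
    (ae_of_all _ fun t => (stdNormalDensity_pos t).le) integrable_stdNormalDensity.integrableOn,
    Function.support_eq_univ fun t => (stdNormalDensity_pos t).ne']
  simp

theorem hasDerivAt_Qfun_s10 (x : ℝ) : HasDerivAt Qfun (-stdNormalDensity x) x := by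
  have h : Qfun = fun y => Qfun 0 - ∫ t in (0 : ℝ)..y, stdNormalDensity t := by
    funext y
    rw [← intervalIntegral.integral_Ioi_sub_Ioi' integrable_stdNormalDensity.integrableOn
      integrable_stdNormalDensity.integrableOn, Qfun_eq_integral_stdNormalDensity,
      Qfun_eq_integral_stdNormalDensity, sub_sub_cancel]
  rw [h]
  exact (continuous_stdNormalDensity.integral_hasStrictDerivAt 0 x).hasDerivAt.const_sub _

theorem tendsto_Qfun_atTop : Tendsto Qfun atTop (𝓝 0) :=
  tendsto_integral_Ioi_zero tendsto_id

theorem sq_mul_Qfun_le {x : ℝ} (hx : 0 ≤ x) :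
    x ^ 2 * Qfun x ≤ ∫ t in Set.Ioi x, t ^ 2 * stdNormalDensity t := by
  rw [Qfun_eq_integral_stdNormalDensity, ← integral_const_mul]
  refine setIntegral_mono_on (integrable_stdNormalDensity.const_mul _).integrableOn
    integrable_sq_mul_stdNormalDensity.integrableOn measurableSet_Ioi fun t ht => ?_
  have ht' : x ≤ t := le_of_lt ht
  have := (stdNormalDensity_pos t).le
  gcongr

theorem tendsto_sq_mul_Qfun_atTop : Tendsto (fun x => x ^ 2 * Qfun x) atTop (𝓝 0) := by
  refine tendsto_of_tendsto_of_tendsto_of_le_of_le' tendsto_const_nhds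
    (tendsto_integral_Ioi_zero (μ := volume) (f := fun t => t ^ 2 * stdNormalDensity t) tendsto_id)
    (Eventually.of_forall fun x => mul_nonneg (sq_nonneg x) (Qfun_pos x).le) ?_
  filter_upwards [eventually_ge_atTop 0] with x hx using sq_mul_Qfun_le hx

/-- The derivative `Sd` of `S_ℓ` as a function of the ratio `x = ℓ / α`. -/
noncomputable def SdRatio (x : ℝ) : ℝ :=
  x * stdNormalDensity x + (1 - x ^ 2) * Qfun x

theorem hasDerivAt_SdRatio (x : ℝ) : HasDerivAt SdRatio (-2 * x * Qfun x) x := by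
  have h := ((hasDerivAt_id x).mul (hasDerivAt_stdNormalDensity x)).add
    (((hasDerivAt_pow 2 x).const_sub 1).mul (hasDerivAt_Qfun_s10 x))
  refine h.congr_deriv ?_
  simp only [id]
  push_cast
  ring

theorem strictAntiOn_SdRatio : StrictAntiOn SdRatio (Set.Ici 0) := by
  refine strictAntiOn_of_deriv_neg (convex_Ici 0)
    (fun x _ => (hasDerivAt_SdRatio x).continuousAt.continuousWithinAt) fun x hx => ?_
  rw [interior_Ici, Set.mem_Ioi] at hx
  rw [(hasDerivAt_SdRatio x).deriv]
  have := mul_pos hx (Qfun_pos x)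
  linarith

theorem SdRatio_zero : SdRatio 0 = 1 / 2 := by
  simp [SdRatio, Qfun_zero]

theorem tendsto_SdRatio_atTop : Tendsto SdRatio atTop (𝓝 0) := by
  have h := (tendsto_mul_stdNormalDensity_atTop.add tendsto_Qfun_atTop).sub
    tendsto_sq_mul_Qfun_atTop
  rw [add_zero, sub_zero] at h
  refine h.congr fun x => ?_
  rw [SdRatio]
  ring

theorem SdRatio_pos {x : ℝ} (hx : 0 ≤ x) : 0 < SdRatio x := by
  have hx1 : 0 ≤ x + 1 := by linarith
  refine lt_of_le_of_lt ?_ (strictAntiOn_SdRatio hx hx1 (lt_add_one x))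
  refine le_of_tendsto tendsto_SdRatio_atTop ?_
  filter_upwards [eventually_ge_atTop (x + 1)] with y hy
  exact strictAntiOn_SdRatio.antitoneOn hx1 (hx1.trans hy) hy

theorem Sd_eq_SdRatio (ℓ : ℕ) (α : ℝ) : Sd ℓ α = SdRatio (ℓ / α) := by
  have h : -(ℓ : ℝ) ^ 2 / (2 * α ^ 2) = -((ℓ : ℝ) / α) ^ 2 / 2 := by
    rw [div_pow, ← neg_div, div_div, mul_comm]
  rw [Sd, SdRatio, stdNormalDensity, h, div_pow, ← div_div]
  ring

theorem stmt10 (ℓ : ℕ) (hℓ : 0 < ℓ) :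
    StrictMonoOn (Sd ℓ) (Set.Ioi (0 : ℝ)) ∧
    (∀ α : ℝ, 0 < α → 0 < Sd ℓ α ∧ Sd ℓ α < 1 / 2) ∧
    Filter.Tendsto (Sd ℓ) (nhdsWithin 0 (Set.Ioi 0)) (nhds 0) ∧
    Filter.Tendsto (Sd ℓ) Filter.atTop (nhds (1 / 2)) := by
  have hpos : (0 : ℝ) < ℓ := Nat.cast_pos.2 hℓ
  have hSd : Sd ℓ = fun α => SdRatio (ℓ / α) := funext (Sd_eq_SdRatio ℓ)
  rw [hSd]
  refine ⟨fun a ha b hb hab => ?_, fun α hα => ⟨SdRatio_pos (by positivity), ?_⟩, ?_, ?_⟩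
  · exact strictAntiOn_SdRatio (div_pos hpos hb).le (div_pos hpos ha).le
      (div_lt_div_of_pos_left hpos ha hab)
  · rw [← SdRatio_zero]
    exact strictAntiOn_SdRatio Set.self_mem_Ici (div_pos hpos hα).le (div_pos hpos hα)
  · exact tendsto_SdRatio_atTop.comp (tendsto_inv_nhdsGT_zero.const_mul_atTop hpos)
  · rw [← SdRatio_zero]
    exact (hasDerivAt_SdRatio 0).continuousAt.tendsto.comp (tendsto_id.const_div_atTop _)
end
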